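/- There exists a ≥ 1, depending only on n, p, λ and Λ, such that for every x ∈ Q_{6n} \ closure(Q_{1/(8n)}) with x_i ≠ 0 for all i ∈ {1,…,n}, one has M⁻_{λ,Λ}( D_p(DΦ₀(x))·D²Φ₀(x)·D_p(DΦ₀(x)) ) − Λ·|DΦ₀(x)|^{p+1} > 0. -/

import Mathlib

noncomputable section

/-- Euclidean space ℝⁿ. -/
abbrev En (n : ℕ) := EuclideanSpace ℝ (Fin n)

/-- The gradient vector `Dψ(x)` of coordinatewise partial derivatives. -/
noncomputable def gradVec {n : ℕ} (ψ : En n → ℝ) (x : En n) : Fin n → ℝ :=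
  fun i => fderiv ℝ ψ x (EuclideanSpace.single i 1)

/-- The Hessian matrix `D²ψ(x)` of second partial derivatives. -/
noncomputable def hessMat {n : ℕ} (ψ : En n → ℝ) (x : En n) : Matrix (Fin n) (Fin n) ℝ :=
  Matrix.of fun i j =>
    fderiv ℝ (fun y => fderiv ℝ ψ y (EuclideanSpace.single j 1)) x (EuclideanSpace.single i 1)

/-- The exponent `b = 1 + 1/(1+p)`. -/
noncomputable def bexp (p : ℝ) : ℝ := 1 + 1 / (1 + p)

/-- `|x|_s = Σᵢ |xᵢ|^s`. -/
noncomputable def normS {n : ℕ} (s : ℝ) (x : En n) : ℝ := ∑ i, |x i| ^ s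

/-- `x^s`, the vector with components `|xᵢ|^{s−1}·xᵢ`. -/
noncomputable def vpowS {n : ℕ} (s : ℝ) (x : En n) : Fin n → ℝ := fun i => |x i| ^ (s - 1) * x i

/-- The barrier function `Φ₀(x) = (1/(ab))·(Σᵢ |xᵢ|^b)^{−a}` with `b = 1 + 1/(1+p)`. -/
noncomputable def Phi0 (n : ℕ) (p a : ℝ) (x : En n) : ℝ :=
  (1 / (a * bexp p)) * (∑ i, |x i| ^ bexp p) ^ (-a)

/-- `D_p(z) = diag(|z₁|^{p/2},…,|zₙ|^{p/2})`. -/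
noncomputable def Dp {n : ℕ} (p : ℝ) (z : Fin n → ℝ) : Matrix (Fin n) (Fin n) ℝ :=
  Matrix.diagonal fun i => |z i| ^ (p / 2)

/-- The Pucci extremal operator `M⁻_{λ,Λ}(M) = λ·Σ_{e>0} e + Λ·Σ_{e<0} e`. -/
noncomputable def pucciInf {ι : Type*} [Fintype ι] [DecidableEq ι] (lam Lam : ℝ)
    (M : Matrix ι ι ℝ) : ℝ :=
  if h : M.IsHermitian then
    ∑ i, (lam * max (h.eigenvalues i) 0 + Lam * min (h.eigenvalues i) 0)
  else 0

/-- Euclidean norm of a vector of `Fin n → ℝ`. -/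
noncomputable def vnorm {n : ℕ} (v : Fin n → ℝ) : ℝ := Real.sqrt (∑ i, v i ^ 2)

/-- The open cube `Q_r = {x : |x_i| < r for all i}`. -/
def Qcube (n : ℕ) (r : ℝ) : Set (En n) := {x | ∀ i, |x i| < r}

theorem bexp_sub_one (p : ℝ) : bexp p - 1 = 1 / (1 + p) := by
  simp [bexp]

theorem bexp_sub_one_mul {p : ℝ} (hp : 0 ≤ p) : (bexp p - 1) * (p + 1) = 1 := by
  rw [bexp_sub_one]
  field_simp
  ring

theorem bexp_sub_one_pos {p : ℝ} (hp : 0 ≤ p) : 0 < bexp p - 1 := by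
  rw [bexp_sub_one]
  positivity

theorem bexp_sub_one_le_one {p : ℝ} (hp : 0 ≤ p) : bexp p - 1 ≤ 1 := by
  nlinarith [bexp_sub_one_mul hp, bexp_sub_one_pos hp]

theorem normS_pos {n : ℕ} (hn : 1 ≤ n) (s : ℝ) {x : En n} (hx : ∀ i, x i ≠ 0) :
    0 < normS s x :=
  Finset.sum_pos (fun i _ => Real.rpow_pos_of_pos (abs_pos.2 (hx i)) _) ⟨⟨0, hn⟩, by simp⟩

theorem abs_vpowS {n : ℕ} (s : ℝ) {x : En n} {i : Fin n} (hx : x i ≠ 0) :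
    |vpowS s x i| = |x i| ^ s := by
  have h := abs_pos.2 hx
  rw [vpowS, abs_mul, abs_of_nonneg (Real.rpow_nonneg h.le _), Real.rpow_sub_one h.ne']
  field_simp

theorem hasDerivAt_abs_rpow_mul_self (c : ℝ) {t : ℝ} (ht : t ≠ 0) :
    HasDerivAt (fun t : ℝ => |t| ^ c * t) ((c + 1) * |t| ^ c) t := by
  have h := ((hasDerivAt_abs ht).rpow_const (p := c) (Or.inl (abs_ne_zero.2 ht))).mul
    (hasDerivAt_id t)
  refine h.congr_deriv ?_
  have hs : (SignType.sign t : ℝ) * t = |t| := sign_mul_self t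
  simp only [id]
  rw [Real.rpow_sub_one (abs_ne_zero.2 ht)]
  have hq : |t| ^ c / |t| * |t| = |t| ^ c := div_mul_cancel₀ _ (abs_ne_zero.2 ht)
  linear_combination (c * (|t| ^ c / |t|)) * hs + c * hq

theorem hasFDerivAt_normS {n : ℕ} {s : ℝ} (hs : 1 < s) (x : En n) :
    HasFDerivAt (normS s)
      (∑ i, (s * vpowS (s - 1) x i) • (EuclideanSpace.proj i : En n →L[ℝ] ℝ)) x := by
  refine HasFDerivAt.fun_sum fun i _ => ?_
  have h := (hasDerivAt_abs_rpow (x i) hs).comp_hasFDerivAt x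
    (EuclideanSpace.proj i : En n →L[ℝ] ℝ).hasFDerivAt
  refine h.congr_fderiv ?_
  congr 1
  simp only [vpowS]
  ring_nf

theorem hasFDerivAt_vpowS {n : ℕ} (s : ℝ) {x : En n} {j : Fin n} (hx : x j ≠ 0) :
    HasFDerivAt (fun y : En n => vpowS s y j)
      ((s * |x j| ^ (s - 1)) • (EuclideanSpace.proj j : En n →L[ℝ] ℝ)) x := by
  have h := (hasDerivAt_abs_rpow_mul_self (s - 1) hx).comp_hasFDerivAt x
    (EuclideanSpace.proj j : En n →L[ℝ] ℝ).hasFDerivAt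
  simpa [Function.comp_def, vpowS] using h

theorem hasFDerivAt_normS_rpow {n : ℕ} {s : ℝ} (hs : 1 < s) (r : ℝ) {x : En n}
    (hx : normS s x ≠ 0) :
    HasFDerivAt (fun y => normS s y ^ r)
      ((r * normS s x ^ (r - 1)) •
        ∑ i, (s * vpowS (s - 1) x i) • (EuclideanSpace.proj i : En n →L[ℝ] ℝ)) x :=
  (hasFDerivAt_normS hs x).rpow_const (Or.inl hx)

theorem sum_proj_single {n : ℕ} (c : Fin n → ℝ) (i : Fin n) :
    (∑ k, c k • (EuclideanSpace.proj k : En n →L[ℝ] ℝ)) (EuclideanSpace.single i 1) = c i := by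
  simp

theorem gradVec_Phi0 {n : ℕ} (hn : 1 ≤ n) {p a : ℝ} (hp : 0 ≤ p) (ha : a ≠ 0) {x : En n}
    (hx : ∀ i, x i ≠ 0) (i : Fin n) :
    gradVec (Phi0 n p a) x i =
      -(normS (bexp p) x ^ (-a - 1) * vpowS (bexp p - 1) x i) := by
  have hb := bexp_sub_one_pos hp
  have h : HasFDerivAt (Phi0 n p a) _ x :=
    (hasFDerivAt_normS_rpow (by linarith) (-a) (normS_pos hn (bexp p) hx).ne').const_mul
      (1 / (a * bexp p))
  have hb' : bexp p ≠ 0 := by linarith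
  rw [gradVec, h.fderiv, smul_apply, smul_apply,
    sum_proj_single]
  simp only [smul_eq_mul]
  field_simp

theorem hessMat_Phi0 {n : ℕ} (hn : 1 ≤ n) {p a : ℝ} (hp : 0 ≤ p) (ha : a ≠ 0) {x : En n}
    (hx : ∀ i, x i ≠ 0) (i j : Fin n) :
    hessMat (Phi0 n p a) x i j =
      normS (bexp p) x ^ (-a - 1) *
        ((a + 1) * bexp p / normS (bexp p) x * (vpowS (bexp p - 1) x i * vpowS (bexp p - 1) x j) -
          if i = j then (bexp p - 1) * |x j| ^ (bexp p - 2) else 0) := by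
  have hb := bexp_sub_one_pos hp
  have hS := (normS_pos hn (bexp p) hx).ne'
  have hev : ∀ᶠ y in nhds x, ∀ i, y i ≠ 0 :=
    Filter.eventually_all.2 fun i =>
      (EuclideanSpace.proj i : En n →L[ℝ] ℝ).continuous.continuousAt.eventually_ne (hx i)
  have heq : (fun y => fderiv ℝ (Phi0 n p a) y (EuclideanSpace.single j 1)) =ᶠ[nhds x]
      fun y => -(normS (bexp p) y ^ (-a - 1) * vpowS (bexp p - 1) y j) :=
    hev.mono fun y hy => gradVec_Phi0 hn hp ha hy j
  have h := ((hasFDerivAt_normS_rpow (by linarith) (-a - 1) hS).fun_mul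
    (hasFDerivAt_vpowS (bexp p - 1) (hx j))).fun_neg
  rw [hessMat, Matrix.of_apply, heq.fderiv_eq, h.fderiv,
    neg_apply, add_apply,
    smul_apply, smul_apply,
    smul_apply, smul_apply, sum_proj_single,
    Real.rpow_sub_one hS (-a - 1)]
  have hsub : bexp p - 1 - 1 = bexp p - 2 := by ring
  simp only [smul_eq_mul, hsub]
  by_cases hij : i = j
  · subst hij
    simp
    ring
  · simp [hij, Ne.symm hij]
    ring

theorem le_pucciInf {ι : Type*} [Fintype ι] [DecidableEq ι] {lam Lam k : ℝ} (hlL : lam ≤ Lam)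
    (hk : 0 ≤ k) {M : Matrix ι ι ℝ} (hM : M.IsHermitian)
    (h : ∀ v : ι → ℝ, -k * (v ⬝ᵥ v) ≤ v ⬝ᵥ M.mulVec v) :
    lam * M.trace - (Lam - lam) * (Fintype.card ι * k) ≤ pucciInf lam Lam M := by
  rw [pucciInf, dif_pos hM, hM.trace_eq_sum_eigenvalues]
  have hsum : (Fintype.card ι : ℝ) * k = ∑ _i : ι, k := by simp
  rw [hsum, Finset.mul_sum, Finset.mul_sum, ← Finset.sum_sub_distrib]
  refine Finset.sum_le_sum fun i _ => ?_
  have he : -k ≤ hM.eigenvalues i := by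
    have h1 := h (hM.eigenvectorBasis i)
    have h2 : (hM.eigenvectorBasis i : ι → ℝ) ⬝ᵥ (hM.eigenvectorBasis i : ι → ℝ) = 1 := by
      have h3 := hM.eigenvectorBasis.orthonormal.1 i
      rw [EuclideanSpace.norm_eq, Real.sqrt_eq_one] at h3
      simpa [dotProduct, sq] using h3
    rw [hM.mulVec_eigenvectorBasis, dotProduct_smul, h2] at h1
    simpa using h1
  have hmin : -k ≤ min (hM.eigenvalues i) 0 := le_min he (by linarith)
  have hprod := mul_le_mul_of_nonneg_left hmin (sub_nonneg.2 hlL)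
  simp only [RCLike.ofReal_real_eq_id, id]
  have hadd := congrArg (lam * ·) (max_add_min (hM.eigenvalues i) 0)
  linarith

theorem le_pucciInf_rankOne_sub {n : ℕ} {lam Lam c α β : ℝ} (hlL : lam ≤ Lam) (hc : 0 ≤ c)
    (hα : 0 ≤ α) (hβ : 0 ≤ β) (w : Fin n → ℝ) :
    c * (lam * (α * (w ⬝ᵥ w)) - Lam * (n * β)) ≤
      pucciInf lam Lam (c • (α • Matrix.vecMulVec w w - β • (1 : Matrix (Fin n) (Fin n) ℝ))) := by
  have hM : (c • (α • Matrix.vecMulVec w w - β • (1 : Matrix (Fin n) (Fin n) ℝ))).IsHermitian := by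
    ext i j
    simp [Matrix.vecMulVec_apply, Matrix.one_apply, eq_comm, mul_comm]
  refine le_trans (le_of_eq ?_) (le_pucciInf hlL (mul_nonneg hc hβ) hM fun v => ?_)
  · simp [Matrix.trace_sub, Matrix.trace_vecMulVec]
    ring
  · have h : v ⬝ᵥ (c • (α • Matrix.vecMulVec w w - β • (1 : Matrix (Fin n) (Fin n) ℝ))).mulVec v =
        c * (α * (w ⬝ᵥ v) ^ 2 - β * (v ⬝ᵥ v)) := by
      simp [Matrix.smul_mulVec, Matrix.sub_mulVec, Matrix.vecMulVec_mulVec, dotProduct_sub,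
        dotProduct_smul, dotProduct_comm v w, sq]
    rw [h]
    have : 0 ≤ c * (α * (w ⬝ᵥ v) ^ 2) := by positivity
    linarith

theorem Dp_mul_hessMat_mul_Dp {n : ℕ} (hn : 1 ≤ n) {p a : ℝ} (hp : 0 ≤ p) (ha : a ≠ 0) {x : En n}
    (hx : ∀ i, x i ≠ 0) :
    Dp p (gradVec (Phi0 n p a) x) * hessMat (Phi0 n p a) x * Dp p (gradVec (Phi0 n p a) x) =
      (normS (bexp p) x ^ (-a - 1)) ^ (p + 1) •
        (((a + 1) * bexp p / normS (bexp p) x) •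
            Matrix.vecMulVec (fun i => |vpowS (bexp p - 1) x i| ^ (p / 2) * vpowS (bexp p - 1) x i)
              (fun i => |vpowS (bexp p - 1) x i| ^ (p / 2) * vpowS (bexp p - 1) x i) -
          (bexp p - 1) • (1 : Matrix (Fin n) (Fin n) ℝ)) := by
  have hT := Real.rpow_pos_of_pos (normS_pos hn (bexp p) hx) (-a - 1)
  ext i j
  rw [Dp, Matrix.mul_diagonal, Matrix.diagonal_mul, hessMat_Phi0 hn hp ha hx]
  simp only [gradVec_Phi0 hn hp ha hx, abs_neg, abs_mul, abs_of_pos hT, Matrix.smul_apply,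
    Matrix.sub_apply, Matrix.vecMulVec_apply, Matrix.one_apply, smul_eq_mul]
  rw [Real.mul_rpow hT.le (abs_nonneg _), Real.mul_rpow hT.le (abs_nonneg _)]
  set T := normS (bexp p) x ^ (-a - 1)
  have hTp : T ^ (p + 1) = T ^ (p / 2) * T ^ (p / 2) * T := by
    rw [← Real.rpow_add hT, Real.rpow_add_one hT.ne', add_halves]
  rw [hTp]
  by_cases hij : i = j
  · subst hij
    have hone : |vpowS (bexp p - 1) x i| ^ (p / 2) * |vpowS (bexp p - 1) x i| ^ (p / 2) *
        |x i| ^ (bexp p - 2) = 1 := by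
      have h0 := abs_pos.2 (hx i)
      rw [abs_vpowS _ (hx i), ← Real.rpow_mul h0.le, ← Real.rpow_add h0, ← Real.rpow_add h0]
      convert Real.rpow_zero _ using 2
      linear_combination bexp_sub_one_mul hp
    simp only [if_true]
    linear_combination (-(T ^ (p / 2) * T ^ (p / 2) * T * (bexp p - 1))) * hone
  · simp only [hij, if_false]
    ring

theorem dotProduct_abs_rpow_mul_vpowS {n : ℕ} {p : ℝ} (hp : 0 ≤ p) {x : En n}
    (hx : ∀ i, x i ≠ 0) :
    (fun i => |vpowS (bexp p - 1) x i| ^ (p / 2) * vpowS (bexp p - 1) x i) ⬝ᵥ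
      (fun i => |vpowS (bexp p - 1) x i| ^ (p / 2) * vpowS (bexp p - 1) x i) =
      normS (bexp p) x := by
  refine Finset.sum_congr rfl fun i _ => ?_
  have h0 := abs_pos.2 (hx i)
  rw [mul_mul_mul_comm, ← abs_mul_abs_self (vpowS _ x i), abs_vpowS _ (hx i), ← Real.rpow_mul h0.le,
    ← Real.rpow_add h0, ← Real.rpow_add h0, ← Real.rpow_add h0]
  congr 1
  linear_combination bexp_sub_one_mul hp

theorem vnorm_gradVec_Phi0_le {n : ℕ} (hn : 1 ≤ n) {p a r : ℝ} (hp : 0 ≤ p) (ha : a ≠ 0)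
    (hr : 1 ≤ r) {x : En n} (hx : ∀ i, x i ≠ 0) (hxr : ∀ i, |x i| ≤ r) :
    vnorm (gradVec (Phi0 n p a) x) ≤ normS (bexp p) x ^ (-a - 1) * √(n * r ^ 2) := by
  have hT := Real.rpow_pos_of_pos (normS_pos hn (bexp p) hx) (-a - 1)
  rw [vnorm]
  refine Real.sqrt_le_iff.2 ⟨by positivity, ?_⟩
  rw [mul_pow, Real.sq_sqrt (by positivity)]
  have h : ∀ i ∈ Finset.univ, gradVec (Phi0 n p a) x i ^ 2 ≤
      (normS (bexp p) x ^ (-a - 1)) ^ 2 * r ^ 2 := fun i _ => by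
    rw [gradVec_Phi0 hn hp ha hx, neg_sq, mul_pow, ← sq_abs (vpowS _ x i), abs_vpowS _ (hx i)]
    gcongr
    calc |x i| ^ (bexp p - 1) ≤ r ^ (bexp p - 1) :=
          Real.rpow_le_rpow (abs_nonneg _) (hxr i) (bexp_sub_one_pos hp).le
      _ ≤ r ^ (1 : ℝ) := Real.rpow_le_rpow_of_exponent_le hr (bexp_sub_one_le_one hp)
      _ = r := Real.rpow_one r
  refine (Finset.sum_le_sum h).trans (le_of_eq ?_)
  simp
  ring

/-- **The barrier is a subsolution** (inequality (4.1)): there is `a ≥ 1`, depending only on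
`n, p, λ, Λ`, such that `M⁻(D_p(DΦ₀) D²Φ₀ D_p(DΦ₀)) − Λ|DΦ₀|^{p+1} > 0` on
`Q_{6n} \ closure(Q_{1/(8n)})` away from the coordinate hyperplanes. -/
theorem barrier_subsolution (n : ℕ) (hn : 1 ≤ n) (lam Lam p : ℝ)
    (hlam : 0 < lam) (hlL : lam ≤ Lam) (hp : 0 ≤ p) :
    ∃ a : ℝ, 1 ≤ a ∧
      ∀ x : En n, x ∈ Qcube n (6 * n) \ closure (Qcube n (1 / (8 * n))) →
        (∀ i, x i ≠ 0) →
        0 < pucciInf lam Lam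
              (Dp p (gradVec (Phi0 n p a) x) * hessMat (Phi0 n p a) x *
                Dp p (gradVec (Phi0 n p a) x))
            - Lam * vnorm (gradVec (Phi0 n p a) x) ^ (p + 1) := by
  set C : ℝ := √(n * (6 * n) ^ 2) ^ (p + 1)
  have hLam : 0 < Lam := hlam.trans_le hlL
  have hn' : (1 : ℝ) ≤ n := mod_cast hn
  have hC : 0 ≤ C := by positivity
  refine ⟨1 + (Lam * n + Lam * C) / lam, ?_, fun x hxQ hx => ?_⟩
  · have : 0 ≤ (Lam * n + Lam * C) / lam := by positivity
    linarith
  set a : ℝ := 1 + (Lam * n + Lam * C) / lam with ha_def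
  have hla : lam * a = lam + (Lam * n + Lam * C) := by
    rw [ha_def]
    field_simp
  have ha : 0 < a := by positivity
  have hS := normS_pos hn (bexp p) hx
  have hT := Real.rpow_pos_of_pos hS (-a - 1)
  have hc := Real.rpow_pos_of_pos hT (p + 1)
  have hb := bexp_sub_one_pos hp
  have hb1 := bexp_sub_one_le_one hp
  have hgrad : vnorm (gradVec (Phi0 n p a) x) ^ (p + 1) ≤
      (normS (bexp p) x ^ (-a - 1)) ^ (p + 1) * C := by
    rw [← Real.mul_rpow hT.le (Real.sqrt_nonneg _)]
    exact Real.rpow_le_rpow (Real.sqrt_nonneg _)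
      (vnorm_gradVec_Phi0_le hn hp ha.ne' (by linarith) hx fun i => (hxQ.1 i).le) (by linarith)
  have hpucci := le_pucciInf_rankOne_sub (lam := lam) hlL hc.le
    (α := (a + 1) * bexp p / normS (bexp p) x) (div_nonneg (by nlinarith) hS.le) hb.le
    (fun i => |vpowS (bexp p - 1) x i| ^ (p / 2) * vpowS (bexp p - 1) x i)
  rw [← Dp_mul_hessMat_mul_Dp hn hp ha.ne' hx, dotProduct_abs_rpow_mul_vpowS hp hx,
    div_mul_cancel₀ _ hS.ne'] at hpucci
  refine sub_pos.2 (lt_of_lt_of_le ?_ hpucci)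
  refine (mul_le_mul_of_nonneg_left hgrad hLam.le).trans_lt ?_
  rw [mul_left_comm]
  refine mul_lt_mul_of_pos_left ?_ hc
  have h1 : lam * (a + 1) ≤ lam * ((a + 1) * bexp p) :=
    mul_le_mul_of_nonneg_left (by nlinarith) hlam.le
  have h2 : Lam * (n * (bexp p - 1)) ≤ Lam * n :=
    mul_le_mul_of_nonneg_left (by nlinarith) hLam.le
  linarith
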